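/- arXiv:2601.09455 — 6 statements merged into one kernel-verified Lean document; each statement's English description precedes it below -/
import Mathlib

section
/- Let φ be a 3-CNF formula over n Boolean variables and let M > 0. For every binary pair (y, z), either h_{φ,M}(y,z) = 0 or h_{φ,M}(y,z) ≥ M. -/
open Finset

/-- A literal over variables indexed by `Fin n`: a variable index and a polarity. -/
abbrev Lit (n : ℕ) := Fin n × Bool

/-- A clause: a triple of literals. -/
abbrev Clause (n : ℕ) := Lit n × Lit n × Lit n

/-- A 3-CNF formula: a finite list of clauses. -/
abbrev CNF (n : ℕ) := List (Clause n)

/-- The literal indicator at the pair `(y, z)`. -/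
def litInd {n : ℕ} (y z : Fin n → ℝ) (ℓ : Lit n) : ℝ :=
  if ℓ.2 then y ℓ.1 else z ℓ.1

/-- The one-hidden-layer ReLU regressor `h_{φ,M}`. -/
def hReg {n : ℕ} (φ : CNF n) (M : ℝ) (y z : Fin n → ℝ) : ℝ :=
  M * (φ.map (fun C =>
        max 0 (1 - litInd y z C.1 - litInd y z C.2.1 - litInd y z C.2.2))).sum
    + M * ∑ i, max 0 (y i + z i - 1)

/-- A vector is binary if all of its entries lie in `{0, 1}`. -/
def BinaryVec {n : ℕ} (x : Fin n → ℝ) : Prop := ∀ i, x i = 0 ∨ x i = 1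

/-- An assignment satisfies a literal `(i, b)` iff `σ i = b`. -/
abbrev litSat {n : ℕ} (σ : Fin n → Bool) (ℓ : Lit n) : Prop := σ ℓ.1 = ℓ.2

/-- An assignment satisfies a clause iff it satisfies one of its three literals. -/
abbrev clauseSat {n : ℕ} (σ : Fin n → Bool) (C : Clause n) : Prop :=
  litSat σ C.1 ∨ litSat σ C.2.1 ∨ litSat σ C.2.2

/-- An assignment satisfies a 3-CNF formula iff it satisfies every clause. -/
def cnfSat {n : ℕ} (σ : Fin n → Bool) (φ : CNF n) : Prop := ∀ C ∈ φ, clauseSat σ C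

theorem BinaryVec.litInd_eq_zero_or_one {n : ℕ} {y z : Fin n → ℝ} (hy : BinaryVec y)
    (hz : BinaryVec z) (ℓ : Lit n) : litInd y z ℓ = 0 ∨ litInd y z ℓ = 1 := by
  unfold litInd
  split_ifs
  exacts [hy _, hz _]

/-- A clause contributes `0` or `1` on binary pairs. -/
theorem max_zero_one_sub_mem_mrange_natCast {a b c : ℝ} (ha : a = 0 ∨ a = 1) (hb : b = 0 ∨ b = 1)
    (hc : c = 0 ∨ c = 1) :
    max 0 (1 - a - b - c) ∈ AddMonoidHom.mrange (Nat.castAddMonoidHom ℝ) := by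
  by_cases h : a = 0 ∧ b = 0 ∧ c = 0
  · obtain ⟨rfl, rfl, rfl⟩ := h
    exact ⟨1, by simp⟩
  · refine ⟨0, ?_⟩
    rw [map_zero, eq_comm, max_eq_left_iff]
    grind

/-- A variable contributes `0` or `1` on binary pairs. -/
theorem max_zero_add_sub_one_mem_mrange_natCast {a b : ℝ} (ha : a = 0 ∨ a = 1)
    (hb : b = 0 ∨ b = 1) :
    max 0 (a + b - 1) ∈ AddMonoidHom.mrange (Nat.castAddMonoidHom ℝ) := by
  rcases ha with rfl | rfl <;> rcases hb with rfl | rfl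
  exacts [⟨0, by simp⟩, ⟨0, by simp⟩, ⟨0, by simp⟩, ⟨1, by simp⟩]

/-- On binary pairs, `h_{φ,M}` is a natural multiple of `M`. -/
theorem BinaryVec.exists_hReg_eq_mul_natCast {n : ℕ} {y z : Fin n → ℝ} (hy : BinaryVec y)
    (hz : BinaryVec z) (φ : CNF n) (M : ℝ) : ∃ k : ℕ, hReg φ M y z = M * k := by
  have hclauses : (φ.map (fun C =>
      max 0 (1 - litInd y z C.1 - litInd y z C.2.1 - litInd y z C.2.2))).sum ∈
      AddMonoidHom.mrange (Nat.castAddMonoidHom ℝ) := by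
    refine list_sum_mem fun x hx => ?_
    obtain ⟨C, -, rfl⟩ := List.mem_map.1 hx
    exact max_zero_one_sub_mem_mrange_natCast (hy.litInd_eq_zero_or_one hz _)
      (hy.litInd_eq_zero_or_one hz _) (hy.litInd_eq_zero_or_one hz _)
  have hvars : ∑ i, max 0 (y i + z i - 1) ∈ AddMonoidHom.mrange (Nat.castAddMonoidHom ℝ) :=
    sum_mem fun i _ => max_zero_add_sub_one_mem_mrange_natCast (hy i) (hz i)
  obtain ⟨k, hk⟩ := add_mem hclauses hvars
  exact ⟨k, by rw [hReg, ← mul_add, ← hk, Nat.coe_castAddMonoidHom]⟩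

/-- on binary pairs, `h_{φ,M}` outputs either `0` or at least `M`. -/
theorem hReg_zero_or_ge {n : ℕ} (φ : CNF n) (M : ℝ) (hM : 0 < M)
    (y z : Fin n → ℝ) (hy : BinaryVec y) (hz : BinaryVec z) :
    hReg φ M y z = 0 ∨ M ≤ hReg φ M y z := by
  obtain ⟨k, hk⟩ := hy.exists_hReg_eq_mul_natCast hz φ M
  rw [hk]
  rcases k.eq_zero_or_pos with rfl | hpos
  · left
    simp
  · right
    exact le_mul_of_one_le_right hM.le (Nat.one_le_cast.2 hpos)
end

section
/- Let φ be a 3-CNF formula over n Boolean variables, let M > 0, and let σ : Fin n → Bool be an assignment satisfying φ. Define the encoding (y_σ, z_σ) by y_σ i = 1 if σ i = true and 0 otherwise, and z_σ i = 1 − y_σ i. Then h_{φ,M}(y_σ, z_σ) = 0. -/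
open Finset

/-- On the encoding of an assignment, the indicator of a literal is its truth value. -/
theorem litInd_encoding {n : ℕ} (σ : Fin n → Bool) (ℓ : Lit n) :
    litInd (fun i => if σ i = true then 1 else 0)
      (fun i => 1 - (if σ i = true then 1 else 0)) ℓ = if litSat σ ℓ then 1 else 0 := by
  obtain ⟨i, b⟩ := ℓ
  cases b <;> rcases Bool.eq_false_or_eq_true (σ i) with h | h <;> simp [litInd, h]

/-- The ReLU unit of a satisfied clause vanishes on the encoding of the assignment. -/
theorem relu_clause_eq_zero {n : ℕ} (σ : Fin n → Bool) (C : Clause n) (hC : clauseSat σ C) :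
    max (0 : ℝ) (1 - (if litSat σ C.1 then 1 else 0) - (if litSat σ C.2.1 then 1 else 0)
      - (if litSat σ C.2.2 then 1 else 0)) = 0 := by
  unfold clauseSat at hC
  apply max_eq_left
  split_ifs <;> first | norm_num; done | tauto

/-- a satisfying assignment, encoded as `(y_σ, z_σ)`, is mapped to `0` by `h_{φ,M}`. -/
theorem hReg_eq_zero_of_sat {n : ℕ} (φ : CNF n) (M : ℝ) (hM : 0 < M)
    (σ : Fin n → Bool) (hσ : cnfSat σ φ) :
    hReg φ M (fun i => if σ i = true then 1 else 0)
      (fun i => 1 - (if σ i = true then 1 else 0)) = 0 := by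
  simp only [hReg, litInd_encoding]
  have hclauses : (φ.map (fun C => max (0 : ℝ) (1 - (if litSat σ C.1 then 1 else 0)
      - (if litSat σ C.2.1 then 1 else 0) - (if litSat σ C.2.2 then 1 else 0)))).sum = 0 := by
    apply List.sum_eq_zero
    intro x hx
    obtain ⟨C, hC, rfl⟩ := List.mem_map.mp hx
    exact relu_clause_eq_zero σ C (hσ C hC)
  rw [hclauses]
  simp
end

section
/- Let φ be a 3-CNF formula over n Boolean variables and let M > 0. If (y, z) is a binary pair with h_{φ,M}(y,z) = 0, then the assignment σ : Fin n → Bool defined by σ i = true iff y i = 1 satisfies φ. -/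
open Finset

/-- At a binary pair that sets no variable both true and false, a literal falsified by
`σ i = true ↔ y i = 1` has indicator `0`. -/
theorem litInd_eq_zero_of_not_litSat {n : ℕ} {y z : Fin n → ℝ} (hy : BinaryVec y)
    (hz : BinaryVec z) (hyz : ∀ i, y i + z i ≤ 1) {ℓ : Lit n}
    (h : ¬ litSat (fun i => decide (y i = 1)) ℓ) : litInd y z ℓ = 0 := by
  obtain ⟨i, _ | _⟩ := ℓ
  · have hyi : y i = 1 := by simpa [litSat] using h
    have hzi : z i ≠ 1 := fun hzi => by linarith [hyz i]
    simpa [litInd] using (hz i).resolve_right hzi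
  · have hyi : y i ≠ 1 := by simpa [litSat] using h
    simpa [litInd] using (hy i).resolve_right hyi

/-- if a binary pair `(y,z)` satisfies `h_{φ,M}(y,z) = 0`, then the assignment
`σ i = true ↔ y i = 1` satisfies `φ`. -/
theorem cnfSat_of_hReg_eq_zero {n : ℕ} (φ : CNF n) (M : ℝ) (hM : 0 < M)
    (y z : Fin n → ℝ) (hy : BinaryVec y) (hz : BinaryVec z)
    (h0 : hReg φ M y z = 0) :
    cnfSat (fun i => decide (y i = 1)) φ := by
  set f : Clause n → ℝ := fun C =>
    max 0 (1 - litInd y z C.1 - litInd y z C.2.1 - litInd y z C.2.2)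
  have hf_nonneg : ∀ x ∈ φ.map f, 0 ≤ x :=
    List.forall_mem_map.2 fun _ _ => le_max_left _ _
  have hg_nonneg : ∀ i ∈ Finset.univ, 0 ≤ max 0 (y i + z i - 1) := fun _ _ => le_max_left _ _
  obtain ⟨hφ, hyz⟩ := (add_eq_zero_iff_of_nonneg
    (mul_nonneg hM.le (List.sum_nonneg hf_nonneg))
    (mul_nonneg hM.le (Finset.sum_nonneg hg_nonneg))).1 h0
  replace hφ := (mul_eq_zero.1 hφ).resolve_left hM.ne'
  replace hyz := (mul_eq_zero.1 hyz).resolve_left hM.ne'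
  have hyz_le : ∀ i, y i + z i ≤ 1 := fun i =>
    sub_nonpos.1 (max_eq_left_iff.1 ((Finset.sum_eq_zero_iff_of_nonneg hg_nonneg).1 hyz i
      (Finset.mem_univ i)))
  intro C hC
  have hCle : f C ≤ 0 :=
    hφ ▸ List.single_le_sum hf_nonneg _ (List.mem_map_of_mem hC)
  by_contra hsat
  simp only [clauseSat, not_or] at hsat
  obtain ⟨h₁, h₂, h₃⟩ := hsat
  have hle := (le_max_right _ _).trans hCle
  rw [litInd_eq_zero_of_not_litSat hy hz hyz_le h₁, litInd_eq_zero_of_not_litSat hy hz hyz_le h₂,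
    litInd_eq_zero_of_not_litSat hy hz hyz_le h₃] at hle
  norm_num at hle
end

section
/- Let φ be a 3-CNF formula over n Boolean variables with c ≥ 1 clauses and let M > 0. For every binary vector x : Fin n → ℝ: (i) g_{φ,M}(x) = 0 if and only if the assignment σ_x (σ_x i = true iff x i = 1) satisfies φ; and (ii) if g_{φ,M}(x) ≠ 0 then g_{φ,M}(x) ≥ M. -/
open Finset

/-- The Boolean assignment read off from a real vector: `σ_x i = true` iff `x i = 1`. -/
noncomputable def assignOf {n : ℕ} (x : Fin n → ℝ) : Fin n → Bool := fun i => decide (x i = 1)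

/-- The additive tree model regressor `g_{φ,M}`: the average over the clauses of the
per-clause tree outputs (`0` if the clause is satisfied by `σ_x`, `c·M` otherwise). -/
noncomputable def gReg {n : ℕ} (φ : CNF n) (M : ℝ) (x : Fin n → ℝ) : ℝ :=
  (φ.map (fun C =>
      if clauseSat (assignOf x) C then 0 else (φ.length : ℝ) * M)).sum / (φ.length : ℝ)

theorem List.sum_map_ite_zero_eq_zero {α : Type*} (p : α → Prop) [DecidablePred p] (a : ℝ)
    (l : List α) (h : ∀ x ∈ l, p x) : (l.map fun x => if p x then 0 else a).sum = 0 := by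
  refine List.sum_eq_zero fun y hy => ?_
  obtain ⟨x, hx, rfl⟩ := List.mem_map.1 hy
  exact if_pos (h x hx)

theorem List.le_sum_map_ite_zero {α : Type*} (p : α → Prop) [DecidablePred p] {a : ℝ}
    (ha : 0 ≤ a) {l : List α} {x : α} (hx : x ∈ l) (hp : ¬ p x) :
    a ≤ (l.map fun x => if p x then 0 else a).sum := by
  refine List.single_le_sum (fun y hy => ?_) a (List.mem_map.2 ⟨x, hx, if_neg hp⟩)
  obtain ⟨z, -, rfl⟩ := List.mem_map.1 hy
  split_ifs
  exacts [le_rfl, ha]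

theorem gReg_eq_zero_of_cnfSat {n : ℕ} {φ : CNF n} (M : ℝ) {x : Fin n → ℝ}
    (h : cnfSat (assignOf x) φ) : gReg φ M x = 0 := by
  rw [gReg, List.sum_map_ite_zero_eq_zero (clauseSat (assignOf x)) _ φ h, zero_div]

theorem le_gReg_of_not_cnfSat {n : ℕ} {φ : CNF n} {M : ℝ} (hM : 0 ≤ M) {x : Fin n → ℝ}
    (h : ¬ cnfSat (assignOf x) φ) : M ≤ gReg φ M x := by
  simp only [cnfSat, not_forall] at h
  obtain ⟨C, hC, hCx⟩ := h
  have hpos : (0 : ℝ) < φ.length := by exact_mod_cast List.length_pos_of_mem hC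
  rw [gReg, le_div_iff₀ hpos, mul_comm]
  exact List.le_sum_map_ite_zero (clauseSat (assignOf x)) (by positivity) hC hCx

/-- on binary vectors, `g_{φ,M}(x) = 0` iff `σ_x` satisfies `φ`, and any nonzero
output is at least `M`. -/
theorem gReg_zero_iff_and_ge {n : ℕ} (φ : CNF n) (hc : 1 ≤ φ.length) (M : ℝ) (hM : 0 < M)
    (x : Fin n → ℝ) (hx : BinaryVec x) :
    (gReg φ M x = 0 ↔ cnfSat (assignOf x) φ) ∧ (gReg φ M x ≠ 0 → M ≤ gReg φ M x) := by
  refine ⟨⟨fun h => ?_, gReg_eq_zero_of_cnfSat M⟩, fun h => ?_⟩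
  · by_contra hsat
    exact (hM.trans_le (le_gReg_of_not_cnfSat hM.le hsat)).ne' h
  · exact le_gReg_of_not_cnfSat hM.le fun hsat => h (gReg_eq_zero_of_cnfSat M hsat)
end

section
/- Let φ be a 3-CNF formula over n Boolean variables with c ≥ 1 clauses and let M > 0. Then φ is satisfiable if and only if there exists a binary vector x : Fin n → ℝ with g_{φ,M}(x) = 0. -/
open Finset

/-- A sum of terms equal to `0` or to a fixed positive real vanishes iff every term does. -/
theorem List.sum_map_ite_zero_eq_zero_iff {α : Type*} (l : List α) (p : α → Prop)
    [DecidablePred p] {k : ℝ} (hk : 0 < k) :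
    (l.map (fun a => if p a then 0 else k)).sum = 0 ↔ ∀ a ∈ l, p a := by
  induction l with
  | nil => simp
  | cons a l ih =>
    have hl : 0 ≤ (l.map (fun a => if p a then 0 else k)).sum := by
      refine List.sum_nonneg fun y hy => ?_
      obtain ⟨b, -, rfl⟩ := List.mem_map.mp hy
      split_ifs
      exacts [le_rfl, hk.le]
    rw [List.map_cons, List.sum_cons, List.forall_mem_cons, ← ih]
    by_cases ha : p a
    · simp [ha]
    · simp only [ha, if_false, false_and, iff_false]
      linarith

theorem gReg_eq_zero_iff {n : ℕ} (φ : CNF n) (hc : 1 ≤ φ.length) {M : ℝ} (hM : 0 < M)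
    (x : Fin n → ℝ) : gReg φ M x = 0 ↔ cnfSat (assignOf x) φ := by
  have hlen : (0 : ℝ) < φ.length := by exact_mod_cast hc
  rw [gReg, div_eq_zero_iff, or_iff_left hlen.ne']
  exact List.sum_map_ite_zero_eq_zero_iff φ _ (mul_pos hlen hM)

theorem assignOf_indicator {n : ℕ} (σ : Fin n → Bool) :
    assignOf (fun i => if σ i then (1 : ℝ) else 0) = σ := by
  funext i
  cases h : σ i <;> simp [assignOf, h]

/-- `φ` is satisfiable iff some binary vector is mapped to `0` by `g_{φ,M}`. -/
theorem satisfiable_iff_exists_gReg_zero {n : ℕ} (φ : CNF n) (hc : 1 ≤ φ.length)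
    (M : ℝ) (hM : 0 < M) :
    (∃ σ : Fin n → Bool, cnfSat σ φ) ↔
      ∃ x : Fin n → ℝ, BinaryVec x ∧ gReg φ M x = 0 := by
  constructor
  · rintro ⟨σ, hσ⟩
    refine ⟨fun i => if σ i then 1 else 0, fun i => ?_, ?_⟩
    · cases h : σ i <;> simp [h]
    · rwa [gReg_eq_zero_iff φ hc hM, assignOf_indicator]
  · rintro ⟨x, -, hx⟩
    exact ⟨assignOf x, (gReg_eq_zero_iff φ hc hM x).mp hx⟩
end

section
/- Let X be a type, let h, C : X → ℝ, let B, K ≥ 0 be reals, set M = √(B·K) + 1, and define f : X → ℝ by f x = (h x)² + C x. Assume 0 ≤ C x ≤ B for all x, and that for all x either h x = 0 or h x ≥ M. If x₀ ∈ X satisfies h x₀ = 0 and x* ∈ X satisfies f x* ≤ K · f x₀, then h x* = 0. -/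
/-- for the Wachter-style objective `f x = (h x)² + C x` with target output `0`,
cost bounded by `0 ≤ C x ≤ B`, and regressor outputs either `0` or at least `M = √(B·K) + 1`:
if `h x₀ = 0` and `x*` is a `K`-approximate solution relative to `x₀`
(`f x* ≤ K · f x₀`), then `h x* = 0`. -/
theorem approx_min_vanishes {X : Type*} (h C : X → ℝ) (B K : ℝ)
    (hB : 0 ≤ B) (hK : 0 ≤ K)
    (hC : ∀ x, 0 ≤ C x ∧ C x ≤ B)
    (hh : ∀ x, h x = 0 ∨ Real.sqrt (B * K) + 1 ≤ h x)
    (x₀ xs : X) (h0 : h x₀ = 0)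
    (happrox : (h xs) ^ 2 + C xs ≤ K * ((h x₀) ^ 2 + C x₀)) :
    h xs = 0 := by
  rcases hh xs with hz | hM
  · exact hz
  · exfalso
    have hs : Real.sqrt (B * K) ^ 2 = B * K := Real.sq_sqrt (mul_nonneg hB hK)
    have hcost : K * C x₀ ≤ K * B := mul_le_mul_of_nonneg_left (hC x₀).2 hK
    have hsq : (Real.sqrt (B * K) + 1) ^ 2 ≤ h xs ^ 2 := by gcongr
    rw [h0] at happrox
    nlinarith [Real.sqrt_nonneg (B * K), (hC xs).1]
end
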